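/- Let λ>0 and 1<p≤∞, and let v be a non-negative measurable weight on (0,∞); set p'=p/(p−1) for p<∞ and p'=1 for p=∞. Then the Laplace-type operator 𝓛 is compact from L^p to L^∞ if and only if ‖v‖_{p'}=(∫_0^∞ v^{p'})^{1/p'} < ∞. -/

import Mathlib

open MeasureTheory Set Filter Topology
open scoped ENNReal NNReal

noncomputable section

/-- The Laplace-type operator `𝓛f(x) = ∫_0^∞ e^{-x y^λ} f(y) v(y) dy`. -/
def Lap (lam : ℝ) (v f : ℝ → ℝ) : ℝ → ℝ :=
  fun x => ∫ y in Ioi (0:ℝ), Real.exp (-(x * y ^ lam)) * f y * v y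

/-- `(∫_0^∞ |g|^r)^{1/r}`, the `L^r(0,∞)` (quasi-)norm. -/
def eN (r : ℝ) (g : ℝ → ℝ) : ℝ≥0∞ :=
  (∫⁻ x in Ioi (0:ℝ), ENNReal.ofReal |g x| ^ r) ^ (1/r)

/-- `‖g‖_∞ = ess sup_{x>0} |g(x)|`. -/
def eNinf (g : ℝ → ℝ) : ℝ≥0∞ :=
  essSup (fun x => ENNReal.ofReal |g x|) (volume.restrict (Ioi (0:ℝ)))

/-- Membership in the closed unit ball of `L^p`, where `p` may be infinite. -/
def inBall (p : ℝ≥0∞) (f : ℝ → ℝ) : Prop :=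
  if p = ⊤ then eNinf f ≤ 1 else eN p.toReal f ≤ 1

/-- Compactness of the Laplace-type operator from `L^p` (`1 < p ≤ ∞`) to `L^∞`: the image of
the closed unit ball of `L^p` is relatively compact in the complete space `L^∞`; equivalently,
every sequence of the unit ball has a subsequence whose image is Cauchy in the `L^∞` norm. -/
def LapCompactToInfty (lam : ℝ) (p : ℝ≥0∞) (v : ℝ → ℝ) : Prop :=
  ∀ f : ℕ → ℝ → ℝ, (∀ n, Measurable (f n)) → (∀ n, inBall p (f n)) →
    ∃ φ : ℕ → ℕ, StrictMono φ ∧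
      ∀ ε : ℝ, 0 < ε → ∃ N : ℕ, ∀ m, N ≤ m → ∀ n, N ≤ n →
        eNinf (fun x => Lap lam v (f (φ m)) x - Lap lam v (f (φ n)) x) < ENNReal.ofReal ε

/-! ### Norms -/

lemma eNinf_eq_eLpNorm (g : ℝ → ℝ) :
    eNinf g = eLpNorm g ⊤ (volume.restrict (Ioi (0:ℝ))) := by
  simp [eNinf, eLpNorm_exponent_top, eLpNormEssSup, Real.enorm_eq_ofReal_abs]

lemma inBall_iff_eLpNorm_le_one {p : ℝ≥0∞} (hp : p ≠ 0) (f : ℝ → ℝ) :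
    inBall p f ↔ eLpNorm f p (volume.restrict (Ioi (0:ℝ))) ≤ 1 := by
  unfold inBall
  split_ifs with h
  · rw [eNinf_eq_eLpNorm, h]
  · simp [eN, eLpNorm_eq_lintegral_rpow_enorm_toReal hp h, Real.enorm_eq_ofReal_abs]

lemma eNinf_le_eNinf_sub_add (g h : ℝ → ℝ) :
    eNinf g ≤ eNinf (fun x => g x - h x) + eNinf h := by
  refine le_trans (essSup_mono_ae (Eventually.of_forall fun x => ?_)) (ENNReal.essSup_add_le _ _)
  rw [Pi.add_apply, ← ENNReal.ofReal_add (abs_nonneg _) (abs_nonneg _)]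
  refine ENNReal.ofReal_le_ofReal ?_
  simpa using abs_add_le (g x - h x) (h x)

/-! ### Hölder's inequality and its sharpness -/

section Duality

variable {α : Type*} [MeasurableSpace α] {μ : Measure α}

lemma enorm_integral_mul_le_eLpNorm_mul_eLpNorm {p q : ℝ≥0∞} [ENNReal.HolderConjugate p q]
    {f g : α → ℝ} (hf : AEStronglyMeasurable f μ) (hg : AEStronglyMeasurable g μ) :
    ‖∫ y, f y * g y ∂μ‖ₑ ≤ eLpNorm f p μ * eLpNorm g q μ := by
  refine (enorm_integral_le_lintegral_enorm _).trans ?_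
  have := eLpNorm_smul_le_mul_eLpNorm (p := p) (q := q) (r := 1) hg hf
  rwa [eLpNorm_one_eq_lintegral_enorm] at this

/-- The norm of a non-negative function in `L^q`, `q < ∞`, is attained by pairing it with a
function in the unit ball of the dual space. -/
lemma exists_integral_mul_eq_eLpNorm {p q : ℝ≥0∞} [ENNReal.HolderConjugate p q] (hq : q ≠ ⊤)
    {w : α → ℝ} (hw : Measurable w) (hw0 : ∀ y, 0 ≤ w y) (hwq : MemLp w q μ) :
    ∃ f : α → ℝ, Measurable f ∧ (∀ y, 0 ≤ f y) ∧ eLpNorm f p μ ≤ 1 ∧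
      ∫ y, f y * w y ∂μ = (eLpNorm w q μ).toReal := by
  have hq1 : 1 ≤ q := ENNReal.HolderConjugate.one_le q p
  have hq0 : q ≠ 0 := (zero_lt_one.trans_le hq1).ne'
  have hQ1 : 1 ≤ q.toReal := by
    simpa using ENNReal.toReal_mono hq hq1
  set a := (eLpNorm w q μ).toReal with ha
  have haN : eLpNorm w q μ = ENNReal.ofReal a := (ENNReal.ofReal_toReal hwq.2.ne).symm
  rcases (ENNReal.toReal_nonneg : 0 ≤ a).eq_or_lt with (h0 : 0 = a) | (hapos : 0 < a)
  · exact ⟨0, measurable_zero, fun _ => le_rfl, by simp, by simp [← h0]⟩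
  set u : α → ℝ := a⁻¹ • w with hu
  have hu0 : ∀ y, 0 ≤ u y := fun y => mul_nonneg (inv_nonneg.2 hapos.le) (hw0 y)
  have huN : eLpNorm u q μ = 1 := by
    rw [hu, eLpNorm_const_smul, haN, Real.enorm_eq_ofReal_abs,
      ← ENNReal.ofReal_mul (abs_nonneg _), abs_of_pos (inv_pos.2 hapos),
      inv_mul_cancel₀ hapos.ne', ENNReal.ofReal_one]
  have huI : ∫ y, u y ^ q.toReal ∂μ = 1 := by
    have h := (hwq.const_smul a⁻¹).eLpNorm_eq_integral_rpow_norm hq0 hq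
    rw [← hu, huN] at h
    have h' := ENNReal.toReal_ofReal (r := (∫ y, ‖u y‖ ^ q.toReal ∂μ) ^ q.toReal⁻¹)
      (by positivity)
    rw [← h, ENNReal.toReal_one] at h'
    simp_rw [Real.norm_of_nonneg (hu0 _)] at h'
    have hI : 0 ≤ ∫ y, u y ^ q.toReal ∂μ :=
      integral_nonneg fun y => Real.rpow_nonneg (hu0 y) _
    rw [← Real.rpow_inv_rpow hI (by positivity : q.toReal ≠ 0), ← h', Real.one_rpow]
  refine ⟨fun y => ‖u y‖ ^ (q.toReal - 1), ?_, fun y => by positivity, ?_, ?_⟩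
  · exact ((hw.const_smul a⁻¹).norm).pow_const _
  · rcases hQ1.eq_or_lt with h1 | h1
    · have hp : p = ⊤ := by
        have hq' : q = 1 := by
          rw [← ENNReal.ofReal_toReal hq, ← h1, ENNReal.ofReal_one]
        subst hq'
        exact ENNReal.HolderConjugate.unique 1 p ⊤
      rw [hp, ← h1]
      exact eLpNormEssSup_le_of_ae_bound (C := 1) (by simp) |>.trans (by simp)
    · rw [eLpNorm_norm_rpow _ (sub_pos.2 h1)]
      have : p * ENNReal.ofReal (q.toReal - 1) = q := by
        rw [ENNReal.ofReal_sub _ zero_le_one, ENNReal.ofReal_toReal hq, ENNReal.ofReal_one]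
        have hinv := ENNReal.HolderConjugate.sub_one_mul_inv q p hq
        have hp0 : p ≠ 0 := ENNReal.HolderConjugate.ne_zero p q
        have hpt : p ≠ ⊤ := (ENNReal.HolderConjugate.ne_top_iff_ne_one p q).2 (by
          rintro rfl
          simp at h1)
        calc p * (q - 1) = p * ((q - 1) * q⁻¹) * q := by
              rw [mul_assoc, mul_assoc, ENNReal.inv_mul_cancel hq0 hq, mul_one]
          _ = q := by rw [hinv, ENNReal.mul_inv_cancel hp0 hpt, one_mul]
      rw [this, huN, ENNReal.one_rpow]
  · have : ∀ y, ‖u y‖ ^ (q.toReal - 1) * w y = a * u y ^ q.toReal := by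
      intro y
      have hwy : w y = a * u y := by
        exact (mul_inv_cancel_left₀ hapos.ne' (w y)).symm
      rcases (hu0 y).eq_or_lt with h | h
      · rw [hwy, ← h, Real.zero_rpow (by positivity)]; simp
      · rw [hwy, Real.norm_of_nonneg (hu0 y), Real.rpow_sub_one h.ne']
        field_simp
    simp_rw [this]
    rw [integral_const_mul, huI, mul_one]

end Duality

/-! ### The kernel and sufficiency -/

/-- `L^q`-continuity of `t ↦ t ^ (y ^ λ) v(y)` on `[0, 1]`. -/
lemma tendsto_eLpNorm_rpow_kernel_sub {lam : ℝ} {v : ℝ → ℝ} (hv : Measurable v)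
    {q : ℝ≥0∞} (hq0 : q ≠ 0) (hq : q ≠ ⊤)
    (hvq : eLpNorm v q (volume.restrict (Ioi (0:ℝ))) < ⊤) (t₀ : unitInterval) :
    Tendsto (fun t : unitInterval => eLpNorm
      (fun y => (t : ℝ) ^ (y ^ lam) * v y - (t₀ : ℝ) ^ (y ^ lam) * v y) q
      (volume.restrict (Ioi (0:ℝ)))) (𝓝 t₀) (𝓝 0) := by
  have hQ : 0 < q.toReal := ENNReal.toReal_pos hq0 hq
  simp_rw [eLpNorm_eq_lintegral_rpow_enorm_toReal hq0 hq]
  have key : Tendsto (fun t : unitInterval => ∫⁻ y in Ioi (0:ℝ),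
      ‖(t : ℝ) ^ (y ^ lam) * v y - (t₀ : ℝ) ^ (y ^ lam) * v y‖ₑ ^ q.toReal) (𝓝 t₀)
      (𝓝 (∫⁻ _ in Ioi (0:ℝ), 0)) := by
    refine tendsto_lintegral_filter_of_dominated_convergence (fun y => ‖v y‖ₑ ^ q.toReal)
      (Eventually.of_forall fun t => by fun_prop) (Eventually.of_forall fun t => ?_)
      (lintegral_rpow_enorm_lt_top_of_eLpNorm_lt_top hq0 hq hvq).ne ?_
    · filter_upwards [ae_restrict_mem measurableSet_Ioi] with y hy
      have hy' : 0 ≤ y ^ lam := Real.rpow_nonneg (le_of_lt hy) _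
      gcongr
      rw [← sub_mul, enorm_mul]
      refine mul_le_of_le_one_left zero_le ?_
      have h1 := Real.rpow_nonneg t.2.1 (y ^ lam)
      have h2 := Real.rpow_le_one t.2.1 t.2.2 hy'
      have h3 := Real.rpow_nonneg t₀.2.1 (y ^ lam)
      have h4 := Real.rpow_le_one t₀.2.1 t₀.2.2 hy'
      rw [Real.enorm_eq_ofReal_abs, ENNReal.ofReal_le_one, abs_le]
      constructor <;> linarith
    · filter_upwards [ae_restrict_mem measurableSet_Ioi] with y hy
      have hy' : 0 < y ^ lam := Real.rpow_pos_of_pos hy _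
      have hc : Continuous fun t : unitInterval =>
          ‖(t : ℝ) ^ (y ^ lam) * v y - (t₀ : ℝ) ^ (y ^ lam) * v y‖ₑ ^ q.toReal := by
        refine (ENNReal.continuous_rpow_const).comp (continuous_enorm.comp ?_)
        exact (((Real.continuous_rpow_const hy'.le).comp continuous_subtype_val).mul
          continuous_const).sub continuous_const
      simpa [hQ] using hc.tendsto t₀
  rw [lintegral_zero] at key
  have h := key.ennrpow_const (1 / q.toReal)
  rwa [ENNReal.zero_rpow_of_pos (by positivity)] at h

lemma eLpNorm_rpow_kernel_le {lam : ℝ} {v : ℝ → ℝ} {q : ℝ≥0∞} (t : unitInterval) :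
    eLpNorm (fun y => (t : ℝ) ^ (y ^ lam) * v y) q (volume.restrict (Ioi (0:ℝ))) ≤
      eLpNorm v q (volume.restrict (Ioi (0:ℝ))) := by
  refine eLpNorm_mono_ae ?_
  filter_upwards [ae_restrict_mem measurableSet_Ioi] with y hy
  rw [norm_mul, Real.norm_of_nonneg (Real.rpow_nonneg t.2.1 _)]
  exact mul_le_of_le_one_left (norm_nonneg _)
    (Real.rpow_le_one t.2.1 t.2.2 (Real.rpow_nonneg (le_of_lt hy) _))

lemma lapCompactToInfty_of_eLpNorm_lt_top {lam : ℝ} {p q : ℝ≥0∞} [ENNReal.HolderConjugate p q]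
    (hq : q ≠ ⊤) {v : ℝ → ℝ} (hv : Measurable v)
    (hvq : eLpNorm v q (volume.restrict (Ioi (0:ℝ))) < ⊤) :
    LapCompactToInfty lam p v := by
  intro f hfm hfb
  set μ := volume.restrict (Ioi (0:ℝ)) with hμ
  have hq0 : q ≠ 0 := ENNReal.HolderConjugate.ne_zero q p
  have hp0 : p ≠ 0 := ENNReal.HolderConjugate.ne_zero p q
  have hfN : ∀ n, eLpNorm (f n) p μ ≤ 1 := fun n => (inBall_iff_eLpNorm_le_one hp0 _).1 (hfb n)
  set K : unitInterval → ℝ → ℝ := fun t y => (t : ℝ) ^ (y ^ lam) * v y with hK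
  have hKm : ∀ t, Measurable (K t) := fun t => by simp only [hK]; fun_prop
  have hKL : ∀ t, MemLp (K t) q μ := fun t =>
    ⟨(hKm t).aestronglyMeasurable, (eLpNorm_rpow_kernel_le t).trans_lt hvq⟩
  have hfL : ∀ n, MemLp (f n) p μ := fun n =>
    ⟨(hfm n).aestronglyMeasurable, (hfN n).trans_lt ENNReal.one_lt_top⟩
  set G : ℕ → unitInterval → ℝ := fun n t => ∫ y, f n y * K t y ∂μ with hG
  have holder : ∀ n (k : ℝ → ℝ), Measurable k → ‖∫ y, f n y * k y ∂μ‖ₑ ≤ eLpNorm k q μ :=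
    fun n k hk => (enorm_integral_mul_le_eLpNorm_mul_eLpNorm (p := p) (q := q)
      (hfm n).aestronglyMeasurable hk.aestronglyMeasurable).trans
      (mul_le_of_le_one_left zero_le (hfN n))
  have hGsub : ∀ n t s, edist (G n t) (G n s) ≤ eLpNorm (fun y => K t y - K s y) q μ := by
    intro n t s
    rw [edist_eq_enorm_sub]
    simp only [hG]
    have hI : ∀ t, Integrable (fun y => f n y * K t y) μ := fun t => (hfL n).integrable_mul (hKL t)
    rw [← integral_sub (hI t) (hI s)]
    simp_rw [← mul_sub]
    exact holder n _ ((hKm t).sub (hKm s))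
  have hequi : Equicontinuous G := by
    intro t₀
    rw [Metric.equicontinuousAt_iff_right]
    intro ε hε
    have hlt := (tendsto_eLpNorm_rpow_kernel_sub (lam := lam) hv hq0 hq hvq t₀).eventually_lt_const
      (ENNReal.ofReal_pos.2 hε)
    filter_upwards [hlt] with t ht n
    rw [dist_comm, ← edist_lt_ofReal]
    exact (hGsub n t t₀).trans_lt ht
  have hGbd : ∀ n t, G n t ∈ Metric.closedBall (0:ℝ) (eLpNorm v q μ).toReal := by
    intro n t
    have h := (holder n _ (hKm t)).trans (eLpNorm_rpow_kernel_le t)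
    rw [mem_closedBall_zero_iff, ← toReal_enorm]
    exact ENNReal.toReal_mono hvq.ne h
  set B : ℕ → BoundedContinuousFunction unitInterval ℝ := fun n =>
    BoundedContinuousFunction.mkOfCompact ⟨G n, hequi.continuous n⟩ with hB
  have hcomp : IsCompact (closure (range B)) := by
    refine BoundedContinuousFunction.arzela_ascoli _
      (isCompact_closedBall (0:ℝ) (eLpNorm v q μ).toReal) _ ?_ ?_
    · rintro _ t ⟨n, rfl⟩
      exact hGbd n t
    · intro t₀ U hU
      filter_upwards [hequi t₀ U hU] with t ht
      rintro ⟨_, n, rfl⟩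
      exact ht n
  obtain ⟨b, -, φ, hφ, hlim⟩ := hcomp.tendsto_subseq fun n => subset_closure (mem_range_self n)
  refine ⟨φ, hφ, fun ε hε => ?_⟩
  obtain ⟨N, hN⟩ := Metric.cauchySeq_iff.1 hlim.cauchySeq (ε / 2) (half_pos hε)
  refine ⟨N, fun m hm n hn => ?_⟩
  have hLap : ∀ n x (hx : 0 < x), Lap lam v (f n) x =
      G n ⟨Real.exp (-x), (Real.exp_pos _).le, Real.exp_le_one_iff.2 (by linarith)⟩ := by
    intro n x hx
    simp only [Lap, hG, hK, ← hμ]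
    congr 1 with y
    rw [← Real.exp_mul, neg_mul]
    ring
  have hle : eNinf (fun x => Lap lam v (f (φ m)) x - Lap lam v (f (φ n)) x) ≤
      ENNReal.ofReal (ε / 2) := by
    refine essSup_le_of_ae_le _ ?_
    filter_upwards [ae_restrict_mem measurableSet_Ioi] with x hx
    refine ENNReal.ofReal_le_ofReal ?_
    rw [hLap _ x hx, hLap _ x hx, ← Real.dist_eq]
    exact (BoundedContinuousFunction.dist_coe_le_dist (f := B (φ m)) (g := B (φ n)) _).trans
      (hN m hm n hn).le
  exact hle.trans_lt ((ENNReal.ofReal_lt_ofReal_iff hε).2 (half_lt_self hε))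

/-! ### Necessity -/

lemma ofReal_le_eNinf_of_forall_Ioo {g : ℝ → ℝ} {c δ : ℝ} (hδ : 0 < δ)
    (h : ∀ x ∈ Ioo 0 δ, c ≤ g x) : ENNReal.ofReal c ≤ eNinf g := by
  by_contra! hlt
  have h1 := ae_lt_of_essSup_lt hlt
  have h2 : ∀ᵐ x ∂(volume.restrict (Ioo 0 δ)), ENNReal.ofReal |g x| < ENNReal.ofReal c :=
    ae_restrict_of_ae_restrict_of_subset Ioo_subset_Ioi_self h1
  have : (ae (volume.restrict (Ioo 0 δ))).NeBot := by
    rw [ae_neBot, Ne, Measure.restrict_eq_zero]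
    simp [hδ]
  obtain ⟨x, hx, hx'⟩ := (h2.and (ae_restrict_mem measurableSet_Ioo)).exists
  exact hx.not_ge (ENNReal.ofReal_le_ofReal ((h x hx').trans (le_abs_self _)))

/-- The truncation of `v` to the set where both `y` and `v y` are at most `n`. -/
def truncWeight (v : ℝ → ℝ) (n : ℕ) : ℝ → ℝ :=
  ({y : ℝ | y ≤ n ∧ v y ≤ n} : Set ℝ).indicator v

lemma measurableSet_truncWeight {v : ℝ → ℝ} (hv : Measurable v) (n : ℕ) :
    MeasurableSet {y : ℝ | y ≤ n ∧ v y ≤ n} :=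
  (measurableSet_le measurable_id measurable_const).inter (measurableSet_le hv measurable_const)

lemma memLp_truncWeight {v : ℝ → ℝ} (hv : Measurable v) (hvpos : ∀ y, 0 ≤ v y) (n : ℕ)
    (q : ℝ≥0∞) : MemLp (truncWeight v n) q (volume.restrict (Ioi (0:ℝ))) := by
  have hE := measurableSet_truncWeight hv n
  have : IsFiniteMeasure ((volume.restrict (Ioi (0:ℝ))).restrict {y : ℝ | y ≤ n ∧ v y ≤ n}) := by
    refine ⟨?_⟩
    rw [Measure.restrict_apply_univ, Measure.restrict_apply hE]
    refine lt_of_le_of_lt (measure_mono (t := Icc (0:ℝ) n) ?_) measure_Icc_lt_top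
    rintro y ⟨⟨h, -⟩, h'⟩
    exact ⟨le_of_lt h', h⟩
  refine (memLp_indicator_iff_restrict hE).2 ?_
  refine MemLp.of_bound hv.aestronglyMeasurable (n : ℝ) ?_
  filter_upwards [ae_restrict_mem hE] with y hy
  rw [Real.norm_of_nonneg (hvpos y)]
  exact hy.2

lemma eLpNorm_le_of_forall_truncWeight {v : ℝ → ℝ} (hv : Measurable v) {q C : ℝ≥0∞}
    (h : ∀ n, eLpNorm (truncWeight v n) q (volume.restrict (Ioi (0:ℝ))) ≤ C) :
    eLpNorm v q (volume.restrict (Ioi (0:ℝ))) ≤ C := by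
  refine (Lp.eLpNorm_lim_le_liminf_eLpNorm (f := truncWeight v)
    (fun n => (hv.indicator (measurableSet_truncWeight hv n)).aestronglyMeasurable) v
    (Eventually.of_forall fun y => ?_)).trans ?_
  · refine tendsto_const_nhds.congr' ?_
    filter_upwards [eventually_ge_atTop (max ⌈y⌉₊ ⌈v y⌉₊)] with n hn
    have h1 : y ≤ n := (Nat.le_ceil y).trans (by exact_mod_cast (le_max_left _ _).trans hn)
    have h2 : v y ≤ n := (Nat.le_ceil _).trans (by exact_mod_cast (le_max_right _ _).trans hn)
    exact (indicator_of_mem (show y ∈ {y : ℝ | y ≤ n ∧ v y ≤ n} from ⟨h1, h2⟩) v).symm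
  · exact (liminf_le_liminf (Eventually.of_forall h)).trans (by simp)

/-- Testing the operator on an extremiser of a truncated weight. -/
lemma exists_inBall_truncWeight_le_eNinf_Lap {lam : ℝ} (hlam : 0 < lam) {p q : ℝ≥0∞}
    [ENNReal.HolderConjugate p q] (hq : q ≠ ⊤) {v : ℝ → ℝ} (hv : Measurable v)
    (hvpos : ∀ y, 0 ≤ v y) (n : ℕ) :
    ∃ f : ℝ → ℝ, Measurable f ∧ inBall p f ∧ eNinf (Lap lam v f) < ⊤ ∧
      ENNReal.ofReal (Real.exp (-1)) * eLpNorm (truncWeight v n) q (volume.restrict (Ioi (0:ℝ)))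
        ≤ eNinf (Lap lam v f) := by
  set μ := volume.restrict (Ioi (0:ℝ)) with hμ
  set E : Set ℝ := {y : ℝ | y ≤ n ∧ v y ≤ n} with hE
  have hEm : MeasurableSet E := measurableSet_truncWeight hv n
  set w := truncWeight v n with hw
  have hw0 : ∀ y, 0 ≤ w y := fun y => indicator_nonneg (fun y _ => hvpos y) y
  have hwL : MemLp w q μ := memLp_truncWeight hv hvpos n q
  obtain ⟨f, hfm, hf0, hfN, hfI⟩ := exists_integral_mul_eq_eLpNorm (p := p) hq
    (hv.indicator hEm) hw0 hwL
  change ∫ y, f y * w y ∂μ = (eLpNorm w q μ).toReal at hfI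
  have hint : Integrable (fun y => f y * w y) μ :=
    MemLp.integrable_mul (p := p) (q := q)
      ⟨hfm.aestronglyMeasurable, hfN.trans_lt ENNReal.one_lt_top⟩ hwL
  have hLap : ∀ x, Lap lam v (E.indicator f) x =
      ∫ y, Real.exp (-(x * y ^ lam)) * (f y * w y) ∂μ := by
    intro x
    simp only [Lap, ← hμ]
    congr 1 with y
    by_cases hy : y ∈ E <;> simp [hw, truncWeight, ← hE, hy, mul_assoc]
  have hintx : ∀ x, 0 < x → Integrable (fun y => Real.exp (-(x * y ^ lam)) * (f y * w y)) μ := by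
    intro x hx
    have hem : Measurable fun y : ℝ => Real.exp (-(x * y ^ lam)) := by fun_prop
    refine hint.mono (hem.aestronglyMeasurable.mul hint.1) ?_
    filter_upwards [ae_restrict_mem measurableSet_Ioi] with y hy
    rw [norm_mul]
    refine mul_le_of_le_one_left (norm_nonneg _) ?_
    rw [Real.norm_of_nonneg (Real.exp_pos _).le, Real.exp_le_one_iff]
    have := Real.rpow_pos_of_pos hy lam
    nlinarith [mul_pos hx this]
  refine ⟨E.indicator f, hfm.indicator hEm, ?_, ?_, ?_⟩
  · exact (inBall_iff_eLpNorm_le_one (ENNReal.HolderConjugate.ne_zero p q) _).2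
      ((eLpNorm_indicator_le f).trans hfN)
  · refine lt_of_le_of_lt (essSup_le_of_ae_le (ENNReal.ofReal (eLpNorm w q μ).toReal) ?_)
      ENNReal.ofReal_lt_top
    filter_upwards [ae_restrict_mem measurableSet_Ioi] with x hx
    refine ENNReal.ofReal_le_ofReal ?_
    rw [hLap, ← hfI, abs_of_nonneg (integral_nonneg fun y =>
      mul_nonneg (Real.exp_pos _).le (mul_nonneg (hf0 y) (hw0 y)))]
    refine integral_mono_ae (hintx x hx) hint ?_
    filter_upwards [ae_restrict_mem measurableSet_Ioi] with y hy
    refine mul_le_of_le_one_left (mul_nonneg (hf0 y) (hw0 y)) ?_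
    rw [Real.exp_le_one_iff]
    have := Real.rpow_pos_of_pos hy lam
    have hx' : 0 < x := hx
    nlinarith [mul_pos hx' this]
  · rw [← ENNReal.ofReal_toReal hwL.2.ne, ← ENNReal.ofReal_mul (Real.exp_pos _).le, ← hfI]
    have hn1 : (0:ℝ) < (n:ℝ) + 1 := by positivity
    refine ofReal_le_eNinf_of_forall_Ioo (δ := (((n:ℝ) + 1) ^ lam)⁻¹) (by positivity) ?_
    intro x hx
    rw [hLap, ← integral_const_mul]
    refine integral_mono_ae (hint.const_mul _) (hintx x hx.1) ?_
    filter_upwards [ae_restrict_mem measurableSet_Ioi] with y hy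
    by_cases hyE : y ∈ E
    · refine mul_le_mul_of_nonneg_right (Real.exp_le_exp.2 (neg_le_neg ?_))
        (mul_nonneg (hf0 y) (hw0 y))
      calc x * y ^ lam ≤ (((n:ℝ) + 1) ^ lam)⁻¹ * ((n:ℝ) + 1) ^ lam :=
            mul_le_mul hx.2.le (Real.rpow_le_rpow (le_of_lt hy) (by linarith [hyE.1]) hlam.le)
              (Real.rpow_nonneg (le_of_lt hy) _) (by positivity)
        _ = 1 := inv_mul_cancel₀ (by positivity)
    · simp [hw, truncWeight, ← hE, hyE]

lemma eLpNorm_lt_top_of_lapCompactToInfty {lam : ℝ} (hlam : 0 < lam) {p q : ℝ≥0∞}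
    [ENNReal.HolderConjugate p q] (hq : q ≠ ⊤) {v : ℝ → ℝ} (hv : Measurable v)
    (hvpos : ∀ y, 0 ≤ v y) (hcomp : LapCompactToInfty lam p v) :
    eLpNorm v q (volume.restrict (Ioi (0:ℝ))) < ⊤ := by
  by_contra htop
  have hunb : ∀ k : ℕ, ∃ f : ℝ → ℝ, Measurable f ∧ inBall p f ∧ eNinf (Lap lam v f) < ⊤ ∧
      (k : ℝ≥0∞) < eNinf (Lap lam v f) := by
    intro k
    by_contra! hk
    have he0 : ENNReal.ofReal (Real.exp (-1)) ≠ 0 := by simp [Real.exp_pos]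
    refine htop (lt_of_le_of_lt (eLpNorm_le_of_forall_truncWeight hv
      (C := k / ENNReal.ofReal (Real.exp (-1))) fun n => ?_)
      (ENNReal.div_lt_top (ENNReal.natCast_ne_top k) he0))
    obtain ⟨f, hfm, hfb, hft, hfl⟩ :=
      exists_inBall_truncWeight_le_eNinf_Lap hlam (p := p) hq hv hvpos n
    rw [ENNReal.le_div_iff_mul_le (Or.inl he0) (Or.inl ENNReal.ofReal_ne_top), mul_comm]
    exact hfl.trans (hk f hfm hfb hft)
  choose f hfm hfb hft hfl using hunb
  obtain ⟨φ, hφ, hC⟩ := hcomp f hfm hfb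
  obtain ⟨N, hN⟩ := hC 1 one_pos
  have hbd : ∀ m, N ≤ m →
      (m : ℝ≥0∞) ≤ ENNReal.ofReal 1 + eNinf (Lap lam v (f (φ N))) := by
    intro m hm
    calc (m : ℝ≥0∞) ≤ (φ m : ℕ) := by exact_mod_cast hφ.id_le m
      _ ≤ eNinf (Lap lam v (f (φ m))) := (hfl _).le
      _ ≤ _ := (eNinf_le_eNinf_sub_add _ (Lap lam v (f (φ N)))).trans
        (add_le_add_left (hN m hm N le_rfl).le _)
  obtain ⟨k, hk⟩ := ENNReal.exists_nat_gt
    (ENNReal.add_lt_top.2 ⟨ENNReal.ofReal_lt_top, hft (φ N)⟩).ne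
  exact (hk.trans_le (by exact_mod_cast le_max_right N k)).not_ge (hbd _ (le_max_left N k))

theorem stmt19 (lam : ℝ) (p : ℝ≥0∞) (hlam : 0 < lam) (hp : 1 < p)
    (v : ℝ → ℝ) (hv : Measurable v) (hvpos : ∀ y, 0 ≤ v y)
    (p' : ℝ) (hp' : p' = if p = ⊤ then 1 else p.toReal / (p.toReal - 1)) :
    LapCompactToInfty lam p v ↔
      (∫⁻ y in Ioi (0:ℝ), ENNReal.ofReal (v y) ^ p') ^ (1/p') < ⊤ := by
  have hconj : 0 < p' ∧ ENNReal.HolderConjugate p (ENNReal.ofReal p') := by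
    split_ifs at hp' with h
    · rw [h, hp', ENNReal.ofReal_one]
      exact ⟨one_pos, inferInstance⟩
    · have hP : 1 < p.toReal := by
        simpa using (ENNReal.toReal_lt_toReal ENNReal.one_ne_top h).2 hp
      have hc : p.toReal.HolderConjugate p' := hp' ▸ Real.HolderConjugate.conjExponent hP
      refine ⟨hc.symm.pos, ?_⟩
      simpa [ENNReal.ofReal_toReal h] using hc.ennrealOfReal
  obtain ⟨hpos, hc⟩ := hconj
  have hnorm : (∫⁻ y in Ioi (0:ℝ), ENNReal.ofReal (v y) ^ p') ^ (1/p') =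
      eLpNorm v (ENNReal.ofReal p') (volume.restrict (Ioi (0:ℝ))) := by
    rw [eLpNorm_eq_lintegral_rpow_enorm_toReal (by simpa using hpos) ENNReal.ofReal_ne_top,
      ENNReal.toReal_ofReal hpos.le]
    simp_rw [Real.enorm_of_nonneg (hvpos _)]
  rw [hnorm]
  exact ⟨eLpNorm_lt_top_of_lapCompactToInfty hlam ENNReal.ofReal_ne_top hv hvpos,
    lapCompactToInfty_of_eLpNorm_lt_top ENNReal.ofReal_ne_top hv⟩
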